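/- Let A : ℝ → ℝ^{d×d} take values in the symmetric positive definite matrices and be differentiable at a point t ∈ ℝ. Then the function s ↦ log A(s) (the matrix logarithm, defined spectrally) is differentiable at t and −(A'(t) · (A^{−1})'(t)) ≥ |(log A)'(t)|², where · is the Frobenius inner product, |·| the Frobenius norm, and primes denote derivatives at t. -/

import Mathlib

open Matrix

/-- The Frobenius inner product `A·B := ∑ i j, A i j * B i j` of two real matrices. -/
noncomputable def fip {d : ℕ} (A B : Matrix (Fin d) (Fin d) ℝ) : ℝ :=
  ∑ i, ∑ j, A i j * B i j

/-- The Frobenius norm `|A| := √(A·A)` of a real matrix. -/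
noncomputable def fnorm {d : ℕ} (A : Matrix (Fin d) (Fin d) ℝ) : ℝ :=
  Real.sqrt (fip A A)

/-- The real power `A^α` of a (symmetric) real matrix, defined through the spectral
decomposition via the continuous functional calculus. -/
noncomputable def mpow {d : ℕ} (A : Matrix (Fin d) (Fin d) ℝ) (α : ℝ) :
    Matrix (Fin d) (Fin d) ℝ :=
  cfc (fun x : ℝ => x ^ α) A

/-- The matrix logarithm of a (symmetric positive definite) real matrix, defined
spectrally via the continuous functional calculus. -/
noncomputable def mlog {d : ℕ} (A : Matrix (Fin d) (Fin d) ℝ) :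
    Matrix (Fin d) (Fin d) ℝ :=
  cfc Real.log A

attribute [local instance] Matrix.frobeniusSeminormedAddCommGroup
  Matrix.frobeniusNormedAddCommGroup Matrix.frobeniusNormedSpace

theorem fip_eq_trace {d : ℕ} (A B : Matrix (Fin d) (Fin d) ℝ) : fip A B = (Aᵀ * B).trace := by
  simp only [fip, trace, diag, mul_apply, transpose_apply]
  exact Finset.sum_comm

theorem fip_conj {d : ℕ} {U : Matrix (Fin d) (Fin d) ℝ} (hU : Uᵀ * U = 1)
    (A B : Matrix (Fin d) (Fin d) ℝ) : fip (U * A * Uᵀ) (U * B * Uᵀ) = fip A B := by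
  rw [fip_eq_trace, fip_eq_trace, transpose_mul, transpose_mul, transpose_transpose]
  have h : U * (Aᵀ * Uᵀ) * (U * B * Uᵀ) = U * (Aᵀ * (Uᵀ * U) * B * Uᵀ) := by
    simp only [Matrix.mul_assoc]
  rw [h, hU, trace_mul_comm, Matrix.mul_one, Matrix.mul_assoc, hU, Matrix.mul_one]

theorem fnorm_sq {d : ℕ} (A : Matrix (Fin d) (Fin d) ℝ) : fnorm A ^ 2 = fip A A :=
  Real.sq_sqrt <| Finset.sum_nonneg fun _ _ => Finset.sum_nonneg fun _ _ => mul_self_nonneg _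

/-- Comparison of the geometric and logarithmic means, in exponential coordinates. -/
theorem sq_mul_exp_add_le (p q : ℝ) :
    (q - p) ^ 2 * Real.exp (p + q) ≤ (Real.exp q - Real.exp p) ^ 2 := by
  have hsinh : ((q - p) / 2) ^ 2 ≤ Real.sinh ((q - p) / 2) ^ 2 := by
    rw [sq_le_sq, Real.abs_sinh]
    exact Real.self_le_sinh_iff.2 (abs_nonneg _)
  have hexp : Real.exp q - Real.exp p = 2 * Real.exp ((p + q) / 2) * Real.sinh ((q - p) / 2) := by
    rw [Real.sinh_eq, mul_assoc, mul_div_assoc', mul_sub, ← Real.exp_add, ← Real.exp_add]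
    ring_nf
  have hsq : Real.exp (p + q) = Real.exp ((p + q) / 2) ^ 2 := by
    rw [← Real.exp_nat_mul]; ring_nf
  rw [hexp, hsq]
  nlinarith [mul_le_mul_of_nonneg_left hsinh (sq_nonneg (Real.exp ((p + q) / 2)))]

theorem dslope_rpow_neg_one {a b : ℝ} (ha : 0 < a) (hb : 0 < b) :
    dslope (fun x : ℝ => x ^ (-1 : ℝ)) a b = -(a * b)⁻¹ := by
  have hfun : (fun x : ℝ => x ^ (-1 : ℝ)) = fun x => x⁻¹ := funext Real.rpow_neg_one
  rw [hfun]
  rcases eq_or_ne b a with rfl | hab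
  · simp [dslope_same, sq]
  · have := sub_ne_zero.2 hab
    rw [dslope_of_ne _ hab, slope_def_field]
    field_simp
    ring

theorem dslope_log_sq_le {a b : ℝ} (ha : 0 < a) (hb : 0 < b) :
    dslope Real.log a b ^ 2 ≤ (a * b)⁻¹ := by
  rcases eq_or_ne b a with rfl | hab
  · simp [dslope_same, sq]
  · have hsub := sub_ne_zero.2 hab
    have h := sq_mul_exp_add_le (Real.log a) (Real.log b)
    rw [Real.exp_add, Real.exp_log ha, Real.exp_log hb] at h
    rw [dslope_of_ne _ hab, slope_def_field, div_pow, inv_eq_one_div,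
      div_le_div_iff₀ (by positivity) (by positivity), one_mul]
    exact h

theorem continuousOn_spectrum {d : ℕ} (B : Matrix (Fin d) (Fin d) ℝ) (f : ℝ → ℝ) :
    ContinuousOn f (spectrum ℝ B) :=
  B.finite_real_spectrum.continuousOn f

theorem sub_smul_one_mul_cfc_dslope {d : ℕ} {B : Matrix (Fin d) (Fin d) ℝ} (hB : B.IsHermitian)
    (f : ℝ → ℝ) (a : ℝ) :
    (B - a • 1) * cfc (dslope f a) B = cfc f B - f a • 1 := by
  have hB' : IsSelfAdjoint B := hB
  have hc := continuousOn_spectrum B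
  have h₁ : B - a • 1 = cfc (fun x => x - a) B := by
    rw [cfc_sub _ _ B (hc _) (hc _), cfc_id' ℝ B, cfc_const a B, Algebra.algebraMap_eq_smul_one]
  have h₂ : cfc f B - f a • 1 = cfc (fun x => f x - f a) B := by
    rw [cfc_sub _ _ B (hc _) (hc _), cfc_const (f a) B, Algebra.algebraMap_eq_smul_one]
  rw [h₁, h₂, ← cfc_mul _ _ B (hc _) (hc _)]
  congr 1
  ext x
  simpa using sub_smul_dslope f a x

theorem cfc_eq_conj_diagonal {d : ℕ} {B : Matrix (Fin d) (Fin d) ℝ} (hB : B.IsHermitian)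
    (f : ℝ → ℝ) :
    cfc f B = (hB.eigenvectorUnitary : Matrix (Fin d) (Fin d) ℝ) *
      diagonal (fun i => f (hB.eigenvalues i)) *
        (hB.eigenvectorUnitary : Matrix (Fin d) (Fin d) ℝ)ᵀ := by
  rw [hB.cfc_eq, IsHermitian.cfc, Unitary.conjStarAlgAut_apply]
  rfl

section Continuity

open scoped Matrix.Norms.L2Operator

theorem continuousAt_cfc_of_posDef {d : ℕ} {A : ℝ → Matrix (Fin d) (Fin d) ℝ}
    (hA : ∀ s, (A s).PosDef) {t : ℝ} (hcont : ContinuousAt A t) {f : ℝ → ℝ}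
    (hf : ContinuousOn f (Set.Ioi 0)) : ContinuousAt (fun s => cfc f (A s)) t := by
  have hspec (s : ℝ) : spectrum ℝ (A s) ⊆ Set.Ioi 0 := by
    rw [(hA s).1.spectrum_real_eq_range_eigenvalues]
    rintro _ ⟨i, rfl⟩
    exact (hA s).eigenvalues_pos i
  have hcfc : ContinuousOn (fun B : Matrix (Fin d) (Fin d) ℝ => cfc f B) (Set.range A) := by
    refine ContinuousOn.cfc_of_mem_nhdsSet (s := Set.Ioi 0) (p := IsSelfAdjoint) f ?_
      continuousOn_id ?_ hf
    · rw [isOpen_Ioi.mem_nhdsSet]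
      simpa using hspec
    · rintro _ ⟨s, rfl⟩
      exact (hA s).1
  exact (hcfc _ ⟨t, rfl⟩).tendsto.comp
    (tendsto_nhdsWithin_iff.2 ⟨hcont, Filter.Eventually.of_forall fun s => ⟨s, rfl⟩⟩)

end Continuity

theorem hasDerivAt_matrix {d : ℕ} {A : ℝ → Matrix (Fin d) (Fin d) ℝ}
    {A' : Matrix (Fin d) (Fin d) ℝ} {t : ℝ} :
    HasDerivAt A A' t ↔ ∀ i j, HasDerivAt (fun s => A s i j) (A' i j) t := by
  refine hasDerivAt_iff_tendsto_slope.trans <| (tendsto_pi_nhds (ι := Fin d)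
    (A := fun _ => Fin d → ℝ)).trans <| forall_congr' fun i => (tendsto_pi_nhds (ι := Fin d)
    (A := fun _ => ℝ)).trans <| forall_congr' fun j => ?_
  rw [hasDerivAt_iff_tendsto_slope]
  rfl

/-- The derivative of a spectral function, tested against an eigenvector at the base point. -/
theorem hasDerivAt_vecMul_cfc {d : ℕ} {A : ℝ → Matrix (Fin d) (Fin d) ℝ}
    (hA : ∀ s, (A s).PosDef) {t : ℝ} {A' : Matrix (Fin d) (Fin d) ℝ} (hdiff : HasDerivAt A A' t)
    {f : ℝ → ℝ} (hf : DifferentiableOn ℝ f (Set.Ioi 0)) {u : Fin d → ℝ} {a : ℝ} (ha : 0 < a)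
    (hu : u ᵥ* A t = a • u) (hfu : u ᵥ* cfc f (A t) = f a • u) :
    HasDerivAt (fun s => u ᵥ* cfc f (A s)) (u ᵥ* A' ᵥ* cfc (dslope f a) (A t)) t := by
  have hg : ContinuousOn (dslope f a) (Set.Ioi 0) :=
    (continuousOn_dslope (Ioi_mem_nhds ha)).2
      ⟨hf.continuousOn, hf.differentiableAt (Ioi_mem_nhds ha)⟩
  have hcfc : ContinuousAt (fun s => cfc (dslope f a) (A s)) t :=
    continuousAt_cfc_of_posDef hA hdiff.continuousAt hg
  have hdiff' : Filter.Tendsto (slope A t) (nhdsWithin t {t}ᶜ) (nhds A') :=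
    hasDerivAt_iff_tendsto_slope.1 hdiff
  rw [hasDerivAt_iff_tendsto_slope]
  have hslope (s : ℝ) : slope (fun s => u ᵥ* cfc f (A s)) t s =
      u ᵥ* slope A t s ᵥ* cfc (dslope f a) (A s) := by
    have h : u ᵥ* (A s - A t) = u ᵥ* (A s - a • 1) := by
      simp [vecMul_sub, hu, vecMul_smul]
    simp only [slope_def_module]
    rw [vecMul_smul, smul_vecMul, h, vecMul_vecMul, sub_smul_one_mul_cfc_dslope (hA s).1,
      vecMul_sub, vecMul_smul, vecMul_one, hfu]
  have hmap : Continuous fun p : Matrix (Fin d) (Fin d) ℝ × Matrix (Fin d) (Fin d) ℝ =>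
      u ᵥ* p.1 ᵥ* p.2 := by fun_prop
  exact ((hmap.tendsto (A', cfc (dslope f a) (A t))).comp
    (hdiff'.prodMk_nhds (hcfc.tendsto.mono_left nhdsWithin_le_nhds))).congr fun s => (hslope s).symm

/-- The Daleckii–Krein formula for the derivative of a spectral function along a curve of positive
definite matrices. -/
theorem hasDerivAt_cfc {d : ℕ} {A : ℝ → Matrix (Fin d) (Fin d) ℝ}
    (hA : ∀ s, (A s).PosDef) {t : ℝ} {A' : Matrix (Fin d) (Fin d) ℝ} (hdiff : HasDerivAt A A' t)
    {f : ℝ → ℝ} (hf : DifferentiableOn ℝ f (Set.Ioi 0)) {U : Matrix (Fin d) (Fin d) ℝ}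
    {l : Fin d → ℝ} (hU : U = (hA t).1.eigenvectorUnitary) (hl : l = (hA t).1.eigenvalues) :
    HasDerivAt (fun s => cfc f (A s))
      (U * of (fun i j => dslope f (l i) (l j) * (Uᵀ * A' * U) i j) * Uᵀ) t := by
  have hUU : Uᵀ * U = 1 := by
    rw [hU]; exact Unitary.coe_star_mul_self (hA t).1.eigenvectorUnitary
  have hUU' : U * Uᵀ = 1 := mul_eq_one_comm.1 hUU
  have hspec (g : ℝ → ℝ) : cfc g (A t) = U * diagonal (fun i => g (l i)) * Uᵀ := by
    rw [hU, hl, cfc_eq_conj_diagonal (hA t).1]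
  have hrow (g : ℝ → ℝ) (i : Fin d) : Uᵀ i ᵥ* cfc g (A t) = g (l i) • Uᵀ i := by
    have h : Uᵀ * cfc g (A t) = diagonal (fun i => g (l i)) * Uᵀ := by
      rw [hspec, ← Matrix.mul_assoc, ← Matrix.mul_assoc, hUU, Matrix.one_mul]
    ext j
    simpa [mul_apply_eq_vecMul, diagonal_mul] using congr_fun₂ h i j
  have hid : cfc (fun x : ℝ => x) (A t) = A t :=
    cfc_id' ℝ (A t) (show IsSelfAdjoint (A t) from (hA t).1)
  have hderiv (i : Fin d) := hasDerivAt_vecMul_cfc hA hdiff hf (u := Uᵀ i) (a := l i)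
    (by rw [hl]; exact (hA t).eigenvalues_pos i) (by simpa [hid] using hrow (fun x => x) i)
    (hrow f i)
  have hval (i : Fin d) : Uᵀ i ᵥ* A' ᵥ* cfc (dslope f (l i)) (A t) =
      (of (fun i j => dslope f (l i) (l j) * (Uᵀ * A' * U) i j) * Uᵀ) i := by
    have h : Uᵀ i ᵥ* A' ᵥ* U = (Uᵀ * A' * U) i := by
      simp [mul_apply_eq_vecMul]
    rw [hspec, ← vecMul_vecMul, ← vecMul_vecMul, h, mul_apply_eq_vecMul]
    congr 1
    ext j
    simp only [vecMul_diagonal, of_apply]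
    exact mul_comm _ _
  simp only [hval] at hderiv
  have hfun (s : ℝ) : cfc f (A s) = U * of (fun i => Uᵀ i ᵥ* cfc f (A s)) := by
    have h : of (fun i => Uᵀ i ᵥ* cfc f (A s)) = Uᵀ * cfc f (A s) := by
      ext i j; simp [mul_apply_eq_vecMul]
    rw [h, ← Matrix.mul_assoc, hUU', Matrix.one_mul]
  rw [funext hfun, Matrix.mul_assoc, hasDerivAt_matrix]
  intro k j
  simp only [Matrix.mul_apply (M := U), of_apply]
  exact HasDerivAt.fun_sum fun i _ => (hasDerivAt_pi.1 (hderiv i) j).const_mul (U k i)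

/-- If `A : ℝ → ℝ^{d×d}` takes symmetric positive definite values and is differentiable at
`t`, then `s ↦ log A(s)` (spectral matrix logarithm) is differentiable at `t` and
`−(A' · (A⁻¹)') ≥ |(log A)'|²`, with primes denoting derivatives at `t`, `·` the Frobenius
inner product and `|·|` the Frobenius norm. -/
theorem hasDerivAt_mlog_inner_ineq {d : ℕ} (hd : 0 < d)
    (A : ℝ → Matrix (Fin d) (Fin d) ℝ) (hA : ∀ s, (A s).PosDef)
    (t : ℝ) (A' : Matrix (Fin d) (Fin d) ℝ) (hdiff : HasDerivAt A A' t) :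
    ∃ L I' : Matrix (Fin d) (Fin d) ℝ,
      HasDerivAt (fun s => mlog (A s)) L t ∧
      HasDerivAt (fun s => mpow (A s) (-1)) I' t ∧
      fnorm L ^ 2 ≤ -(fip A' I') := by
  obtain ⟨U, hU⟩ : ∃ U : Matrix (Fin d) (Fin d) ℝ, U = (hA t).1.eigenvectorUnitary := ⟨_, rfl⟩
  obtain ⟨l, hl⟩ : ∃ l : Fin d → ℝ, l = (hA t).1.eigenvalues := ⟨_, rfl⟩
  have hpos (i : Fin d) : 0 < l i := by rw [hl]; exact (hA t).eigenvalues_pos i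
  have hUU : Uᵀ * U = 1 := by
    rw [hU]; exact Unitary.coe_star_mul_self (hA t).1.eigenvectorUnitary
  have hA' : A' = U * (Uᵀ * A' * U) * Uᵀ := by
    have hUU' : U * Uᵀ = 1 := mul_eq_one_comm.1 hUU
    calc A' = (U * Uᵀ) * A' * (U * Uᵀ) := by rw [hUU', Matrix.one_mul, Matrix.mul_one]
      _ = _ := by simp only [Matrix.mul_assoc]
  have hlog : DifferentiableOn ℝ Real.log (Set.Ioi 0) := fun x hx =>
    (Real.differentiableAt_log (ne_of_gt hx)).differentiableWithinAt
  have hinv : DifferentiableOn ℝ (fun x : ℝ => x ^ (-1 : ℝ)) (Set.Ioi 0) := fun x hx =>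
    (Real.differentiableAt_rpow_const_of_ne _ (ne_of_gt hx)).differentiableWithinAt
  refine ⟨_, _, hasDerivAt_cfc hA hdiff hlog hU hl, hasDerivAt_cfc hA hdiff hinv hU hl, ?_⟩
  generalize Uᵀ * A' * U = G at *
  rw [fnorm_sq, hA', fip_conj hUU, fip_conj hUU]
  simp only [fip, of_apply, ← Finset.sum_neg_distrib, dslope_rpow_neg_one (hpos _) (hpos _)]
  refine Finset.sum_le_sum fun i _ => Finset.sum_le_sum fun j _ => ?_
  nlinarith [mul_le_mul_of_nonneg_right (dslope_log_sq_le (hpos i) (hpos j)) (sq_nonneg (G i j))]
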